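/- Let (X,d,μ) and (X',d',μ') be metric measure spaces with X, X' compact, of diameters D_X and D_{X'}, let δ be a metric coupling and h a probabilistic coupling of μ and μ'. Let S_δ be the relation of pairs (F,F'), with F a μ-centered observable and F' a μ'-centered observable, such that F = f − ∫f dμ and F' = f' − ∫f' dμ' for some metric observables f, f' with f ⊔ f' 1-Lipschitz on (K ⊔ K', δ). Then for all (F,F'), (G,G') ∈ S_δ, |∫_X F G dμ − ∫_{X'} F' G' dμ'| ≤ 2 (D_X + D_{X'}) ∫_{X×X'} δ(x,y) dh(x,y). -/

import Mathlib

open MeasureTheory Metric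

/-- The support of a measure: points all of whose neighborhoods have positive measure. -/
def msupport {X : Type*} [TopologicalSpace X] [MeasurableSpace X] (μ : Measure X) : Set X :=
  {x : X | ∀ U ∈ nhds x, 0 < μ U}

/-- `δ` is a metric coupling of `(X,d,μ)` and `(X',d',μ')`. -/
def MetricCoupling {X X' : Type*} [MetricSpace X] [MetricSpace X']
    [MeasurableSpace X] [MeasurableSpace X']
    (μ : Measure X) (μ' : Measure X') (δ : X ⊕ X' → X ⊕ X' → ℝ) : Prop :=
  (∀ z, δ z z = 0) ∧ (∀ z w, δ z w = δ w z) ∧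
  (∀ z w u, δ z u ≤ δ z w + δ w u) ∧ (∀ z w, δ z w = 0 → z = w) ∧
  (∀ x ∈ msupport μ, ∀ y ∈ msupport μ, δ (Sum.inl x) (Sum.inl y) = dist x y) ∧
  (∀ x ∈ msupport μ', ∀ y ∈ msupport μ', δ (Sum.inr x) (Sum.inr y) = dist x y)

/-- The function `f ⊔ f'` on `K ⊔ K'` is 1-Lipschitz with respect to `δ`. -/
def SqcupLipschitz {X X' : Type*} (K : Set X) (K' : Set X')
    (δ : X ⊕ X' → X ⊕ X' → ℝ) (f : X → ℝ) (f' : X' → ℝ) : Prop :=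
  ∀ z ∈ Sum.inl '' K ∪ Sum.inr '' K', ∀ w ∈ Sum.inl '' K ∪ Sum.inr '' K',
    |Sum.elim f f' z - Sum.elim f f' w| ≤ δ z w

/-- The support used here agrees with `Measure.support`. -/
lemma msupport_eq_support {X : Type*} [TopologicalSpace X] [MeasurableSpace X] (μ : Measure X) :
    msupport μ = μ.support := by
  ext x
  exact (Measure.mem_support_iff_forall x).symm

lemma ae_mem_msupport {X : Type*} [MetricSpace X] [CompactSpace X] [MeasurableSpace X]
    (μ : Measure X) : ∀ᵐ x ∂μ, x ∈ msupport μ := by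
  rw [msupport_eq_support]
  exact Measure.support_mem_ae

lemma ae_mem_msupport_prod {X X' : Type*}
    [MetricSpace X] [CompactSpace X] [MeasurableSpace X]
    [MetricSpace X'] [CompactSpace X'] [MeasurableSpace X']
    {μ : Measure X} {μ' : Measure X'} {h : Measure (X × X')}
    (h1 : h.map Prod.fst = μ) (h2 : h.map Prod.snd = μ') :
    ∀ᵐ q ∂h, q ∈ msupport μ ×ˢ msupport μ' := by
  have hfst : ∀ᵐ q ∂h, q.1 ∈ msupport μ :=
    ae_of_ae_map measurable_fst.aemeasurable (h1 ▸ ae_mem_msupport μ)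
  have hsnd : ∀ᵐ q ∂h, q.2 ∈ msupport μ' :=
    ae_of_ae_map measurable_snd.aemeasurable (h2 ▸ ae_mem_msupport μ')
  filter_upwards [hfst, hsnd] with q hq hq' using ⟨hq, hq'⟩

lemma isClosed_msupport {X : Type*} [TopologicalSpace X] [MeasurableSpace X] (μ : Measure X) :
    IsClosed (msupport μ) := by
  rw [msupport_eq_support]
  exact Measure.isClosed_support

lemma Continuous.integrable_of_compactSpace {X : Type*} [TopologicalSpace X] [CompactSpace X]
    [MeasurableSpace X] [OpensMeasurableSpace X] {μ : Measure X} [IsFiniteMeasure μ]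
    {f : X → ℝ} (hf : Continuous f) : Integrable f μ :=
  hf.integrable_of_hasCompactSupport (HasCompactSupport.of_compactSpace f)

/-- A centered 1-Lipschitz function is bounded by the diameter. -/
lemma abs_sub_integral_le_diam {X : Type*} [MetricSpace X] [CompactSpace X] [MeasurableSpace X]
    [BorelSpace X] (μ : Measure X) [IsProbabilityMeasure μ] {f : X → ℝ}
    (hf : LipschitzWith 1 f) (x : X) : |f x - ∫ y, f y ∂μ| ≤ diam (Set.univ : Set X) := by
  have hint : Integrable f μ := hf.continuous.integrable_of_compactSpace
  have heq : f x - ∫ y, f y ∂μ = ∫ y, (f x - f y) ∂μ := by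
    rw [integral_sub (integrable_const _) hint]
    simp
  rw [heq, ← Real.norm_eq_abs]
  refine (norm_integral_le_of_norm_le_const (C := diam (Set.univ : Set X))
    (Filter.Eventually.of_forall fun y => ?_)).trans (by simp)
  rw [← dist_eq_norm]
  refine (hf.dist_le_mul x y).trans ?_
  simpa using dist_le_diam_of_mem isCompact_univ.isBounded (Set.mem_univ x) (Set.mem_univ y)

lemma MetricCoupling.continuousOn {X X' : Type*}
    [MetricSpace X] [MeasurableSpace X] [MetricSpace X'] [MeasurableSpace X']
    {μ : Measure X} {μ' : Measure X'} {δ : X ⊕ X' → X ⊕ X' → ℝ} (hδ : MetricCoupling μ μ' δ) :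
    ContinuousOn (fun q : X × X' => δ (Sum.inl q.1) (Sum.inr q.2))
      (msupport μ ×ˢ msupport μ') := by
  obtain ⟨-, -, htri, -, hl, hr⟩ := hδ
  refine (LipschitzOnWith.of_le_add_mul (2 : NNReal) ?_).continuousOn
  rintro ⟨x, y⟩ ⟨hx, hy⟩ ⟨x', y'⟩ ⟨hx', hy'⟩
  have hxx := hl x hx x' hx'
  have hyy := hr y' hy' y hy
  have hX : dist x x' ≤ dist (x, y) (x', y') := le_max_left _ _
  have hY : dist y y' ≤ dist (x, y) (x', y') := le_max_right _ _
  have t₁ := htri (Sum.inl x) (Sum.inl x') (Sum.inr y)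
  have t₂ := htri (Sum.inl x') (Sum.inr y') (Sum.inr y)
  rw [dist_comm] at hyy
  push_cast
  linarith

section Coupling

variable {X X' : Type*}
  [MetricSpace X] [CompactSpace X] [MeasurableSpace X] [BorelSpace X]
  [MetricSpace X'] [CompactSpace X'] [MeasurableSpace X'] [BorelSpace X']
  {μ : Measure X} {μ' : Measure X'} {δ : X ⊕ X' → X ⊕ X' → ℝ} {h : Measure (X × X')}

lemma MetricCoupling.integrable [IsFiniteMeasure h] (hδ : MetricCoupling μ μ' δ)
    (h1 : h.map Prod.fst = μ) (h2 : h.map Prod.snd = μ') :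
    Integrable (fun q : X × X' => δ (Sum.inl q.1) (Sum.inr q.2)) h := by
  have hc : IsCompact (msupport μ ×ˢ msupport μ') :=
    (isClosed_msupport μ).isCompact.prod (isClosed_msupport μ').isCompact
  have hi := hδ.continuousOn.integrableOn_compact (μ := h) hc
  rwa [IntegrableOn, Measure.restrict_eq_self_of_ae_mem (ae_mem_msupport_prod h1 h2)] at hi

/-- A difference of integrals over the marginals is an integral over the coupling. -/
lemma integral_sub_integral_eq_of_coupling [IsFiniteMeasure h]
    (h1 : h.map Prod.fst = μ) (h2 : h.map Prod.snd = μ') {f : X → ℝ} {f' : X' → ℝ}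
    (hf : Continuous f) (hf' : Continuous f') :
    ∫ x, f x ∂μ - ∫ x, f' x ∂μ' = ∫ q, (f q.1 - f' q.2) ∂h := by
  have hi : Integrable (fun q : X × X' => f q.1) h :=
    (hf.comp continuous_fst).integrable_of_compactSpace
  have hi' : Integrable (fun q : X × X' => f' q.2) h :=
    (hf'.comp continuous_snd).integrable_of_compactSpace
  rw [integral_sub hi hi', ← h1, ← h2,
    integral_map measurable_fst.aemeasurable hf.aestronglyMeasurable,
    integral_map measurable_snd.aemeasurable hf'.aestronglyMeasurable]

/-- Coupled observables stay close after centering, up to the mean cost of the coupling. -/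
lemma ae_abs_centered_sub_centered_le [IsProbabilityMeasure h] (hδ : MetricCoupling μ μ' δ)
    (h1 : h.map Prod.fst = μ) (h2 : h.map Prod.snd = μ') {f : X → ℝ} {f' : X' → ℝ}
    (hf : Continuous f) (hf' : Continuous f')
    (hff' : SqcupLipschitz (msupport μ) (msupport μ') δ f f') :
    ∀ᵐ q ∂h, |(f q.1 - ∫ x, f x ∂μ) - (f' q.2 - ∫ x, f' x ∂μ')| ≤
      δ (Sum.inl q.1) (Sum.inr q.2) + ∫ q, δ (Sum.inl q.1) (Sum.inr q.2) ∂h := by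
  have hpt : ∀ᵐ q ∂h, |f q.1 - f' q.2| ≤ δ (Sum.inl q.1) (Sum.inr q.2) := by
    filter_upwards [ae_mem_msupport_prod h1 h2] with q hq
    exact hff' _ (Or.inl ⟨_, hq.1, rfl⟩) _ (Or.inr ⟨_, hq.2, rfl⟩)
  have hmean : |∫ x, f x ∂μ - ∫ x, f' x ∂μ'| ≤ ∫ q, δ (Sum.inl q.1) (Sum.inr q.2) ∂h := by
    rw [integral_sub_integral_eq_of_coupling h1 h2 hf hf', ← Real.norm_eq_abs]
    exact norm_integral_le_of_norm_le (hδ.integrable h1 h2) hpt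
  filter_upwards [hpt] with q hq
  rw [abs_le] at *
  constructor <;> linarith

end Coupling

/-- Functional distortion bound for the centered relation `S_δ`. If
`(F,F')` and `(G,G')` belong to `S_δ`, then
`|∫ F G dμ - ∫ F' G' dμ'| ≤ 2 (D_X + D_{X'}) ∫ δ dh` for any probabilistic
coupling `h` of `μ` and `μ'`. -/
theorem centered_covariance_distortion_bound {X X' : Type*}
    [MetricSpace X] [CompactSpace X] [MeasurableSpace X] [BorelSpace X]
    [MetricSpace X'] [CompactSpace X'] [MeasurableSpace X'] [BorelSpace X']
    (μ : Measure X) [IsProbabilityMeasure μ] (μ' : Measure X') [IsProbabilityMeasure μ']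
    (δ : X ⊕ X' → X ⊕ X' → ℝ) (hδ : MetricCoupling μ μ' δ)
    (h : Measure (X × X')) [IsProbabilityMeasure h]
    (h1 : h.map Prod.fst = μ) (h2 : h.map Prod.snd = μ')
    (F G : X → ℝ) (F' G' : X' → ℝ)
    (hFF' : ∃ (f : X → ℝ) (f' : X' → ℝ), LipschitzWith 1 f ∧ LipschitzWith 1 f' ∧
      SqcupLipschitz (msupport μ) (msupport μ') δ f f' ∧
      F = (fun x => f x - ∫ y, f y ∂μ) ∧ F' = (fun x => f' x - ∫ y, f' y ∂μ'))
    (hGG' : ∃ (g : X → ℝ) (g' : X' → ℝ), LipschitzWith 1 g ∧ LipschitzWith 1 g' ∧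
      SqcupLipschitz (msupport μ) (msupport μ') δ g g' ∧
      G = (fun x => g x - ∫ y, g y ∂μ) ∧ G' = (fun x => g' x - ∫ y, g' y ∂μ')) :
    |∫ x, F x * G x ∂μ - ∫ x, F' x * G' x ∂μ'| ≤
      2 * (diam (Set.univ : Set X) + diam (Set.univ : Set X')) *
        ∫ q : X × X', δ (Sum.inl q.1) (Sum.inr q.2) ∂h := by
  obtain ⟨f, f', hf, hf', hff', rfl, rfl⟩ := hFF'
  obtain ⟨g, g', hg, hg', hgg', rfl, rfl⟩ := hGG'
  have hδi := hδ.integrable h1 h2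
  have hF := ae_abs_centered_sub_centered_le hδ h1 h2 hf.continuous hf'.continuous hff'
  have hG := ae_abs_centered_sub_centered_le hδ h1 h2 hg.continuous hg'.continuous hgg'
  have bF := abs_sub_integral_le_diam μ hf
  have bG' := abs_sub_integral_le_diam μ' hg'
  have cFG : Continuous fun x => (f x - ∫ y, f y ∂μ) * (g x - ∫ y, g y ∂μ) := by
    have := hf.continuous
    have := hg.continuous
    fun_prop
  have cFG' : Continuous fun x => (f' x - ∫ y, f' y ∂μ') * (g' x - ∫ y, g' y ∂μ') := by
    have := hf'.continuous
    have := hg'.continuous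
    fun_prop
  rw [integral_sub_integral_eq_of_coupling h1 h2 cFG cFG', ← Real.norm_eq_abs]
  set I := ∫ q : X × X', δ (Sum.inl q.1) (Sum.inr q.2) ∂h with hI
  set D := diam (Set.univ : Set X) + diam (Set.univ : Set X') with hD
  have hbound : ∫ q : X × X', D * (δ (Sum.inl q.1) (Sum.inr q.2) + I) ∂h = 2 * D * I := by
    rw [integral_const_mul, integral_add hδi (integrable_const _), ← hI]
    simp
    ring
  rw [← hbound]
  refine norm_integral_le_of_norm_le ((hδi.add (integrable_const I)).const_mul D) ?_
  filter_upwards [hF, hG] with q hFq hGq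
  rw [Real.norm_eq_abs]
  set a := f q.1 - ∫ y, f y ∂μ
  set b := g q.1 - ∫ y, g y ∂μ
  set a' := f' q.2 - ∫ y, f' y ∂μ'
  set b' := g' q.2 - ∫ y, g' y ∂μ'
  calc |a * b - a' * b'| = |a * (b - b') + b' * (a - a')| := by congr 1; ring
    _ ≤ |a| * |b - b'| + |b'| * |a - a'| := by
      simpa only [abs_mul] using abs_add_le (a * (b - b')) (b' * (a - a'))
    _ ≤ diam (Set.univ : Set X) * (δ (Sum.inl q.1) (Sum.inr q.2) + I) +
        diam (Set.univ : Set X') * (δ (Sum.inl q.1) (Sum.inr q.2) + I) := by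
      gcongr
      · exact bF q.1
      · exact bG' q.2
    _ = D * (δ (Sum.inl q.1) (Sum.inr q.2) + I) := by rw [hD]; ring
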